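/- arXiv:1305.6755 — 6 statements merged into one kernel-verified Lean document; each statement's English description precedes it below -/
import Mathlib

section
/- If x : ℝ → ℝ is differentiable, satisfies μ·x'(t) = cos(x(t)) + a + b·cos(t) for all t ∈ ℝ, and x(0) = 0, then x is odd: x(−t) = −x(t) for all t ∈ ℝ. -/
/-- A solution of the Josephson equation with `x(0) = 0` is odd. -/
theorem josephson_odd_solution (μ a b : ℝ) (hμ : 0 < μ) (x : ℝ → ℝ)
    (hx : Differentiable ℝ x)
    (hode : ∀ t : ℝ, μ * deriv x t = Real.cos (x t) + a + b * Real.cos t)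
    (hx0 : x 0 = 0) :
    ∀ t : ℝ, x (-t) = -x t := by
  have hd : ∀ t, HasDerivAt x ((Real.cos (x t) + a + b * Real.cos t) / μ) t := by
    intro t
    have h : (Real.cos (x t) + a + b * Real.cos t) / μ = deriv x t := by
      rw [← hode t]; field_simp
    rw [h]
    exact (hx t).hasDerivAt
  have hlip : ∀ t : ℝ, LipschitzOnWith (Real.toNNReal (1 / μ))
      (fun y : ℝ => (Real.cos y + a + b * Real.cos t) / μ) Set.univ := by
    intro t
    apply LipschitzWith.lipschitzOnWith
    apply lipschitzWith_of_nnnorm_deriv_le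
    · fun_prop
    · intro y
      have h : HasDerivAt (fun y : ℝ => (Real.cos y + a + b * Real.cos t) / μ)
          (-Real.sin y / μ) y :=
        (((Real.hasDerivAt_cos y).add_const a).add_const _).div_const μ
      rw [h.deriv, ← NNReal.coe_le_coe, Real.coe_toNNReal _ (by positivity), coe_nnnorm,
        Real.norm_eq_abs, abs_div, abs_neg, abs_of_pos hμ]
      gcongr
      exact Real.abs_sin_le_one y
  have key : x = fun t => -x (-t) := by
    refine ODE_solution_unique_univ (t₀ := 0) hlip (fun t => ⟨hd t, trivial⟩)
      (fun t => ⟨?_, trivial⟩) (by simp [hx0])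
    have h := ((hd (-t)).comp t (hasDerivAt_neg t)).neg
    have e : (Real.cos (-x (-t)) + a + b * Real.cos t) / μ
        = -((Real.cos (x (-t)) + a + b * Real.cos (-t)) / μ * -1) := by
      rw [Real.cos_neg, Real.cos_neg]; ring
    exact e ▸ h
  intro t
  have h := congrFun key t
  linarith
end

section
/- Let k be an integer. If x : ℝ → ℝ is differentiable, satisfies μ·x'(t) = cos(x(t)) + a + b·cos(t) for all t ∈ ℝ, x(0) = 0, and x(2π) = 2πk, then x(π) = πk. (If the Poincaré map over the full period shifts the point 0 by 2πk, then the map over the half period shifts it by πk.) -/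
/-- If the Poincaré map of the Josephson equation over a full period shifts the
point `0` by `2πk`, then the map over the half period shifts it by `πk`. -/
theorem josephson_half_period_zero (μ a b : ℝ) (hμ : 0 < μ) (k : ℤ) (x : ℝ → ℝ)
    (hx : Differentiable ℝ x)
    (hode : ∀ t : ℝ, μ * deriv x t = Real.cos (x t) + a + b * Real.cos t)
    (hx0 : x 0 = 0) (hx2pi : x (2 * Real.pi) = 2 * Real.pi * k) :
    x Real.pi = Real.pi * k := by
  have hcos : LipschitzWith 1 Real.cos := by
    apply lipschitzWith_of_nnnorm_deriv_le Real.differentiable_cos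
    intro t
    rw [← NNReal.coe_le_coe]
    simpa using Real.abs_sin_le_one t
  have hd : ∀ t, HasDerivAt x (μ⁻¹ * (Real.cos (x t) + a + b * Real.cos t)) t := by
    intro t
    rw [← hode t, inv_mul_cancel_left₀ hμ.ne']
    exact (hx t).hasDerivAt
  have key : x = fun t => 2 * Real.pi * k - x (2 * Real.pi - t) := by
    refine ODE_solution_unique_univ (t₀ := 0) (s := fun _ => Set.univ)
      (v := fun t y => μ⁻¹ * (Real.cos y + a + b * Real.cos t))
      (K := Real.toNNReal μ⁻¹) ?_ (fun t => ⟨hd t, trivial⟩) (fun t => ⟨?_, trivial⟩) ?_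
    · intro t
      apply LipschitzWith.lipschitzOnWith
      apply LipschitzWith.of_dist_le_mul
      intro y z
      have h := hcos.dist_le_mul y z
      have hp : 0 < μ⁻¹ := inv_pos.mpr hμ
      rw [Real.coe_toNNReal _ hp.le]
      simp only [Real.dist_eq, NNReal.coe_one, one_mul] at h ⊢
      rw [← mul_sub, abs_mul, abs_of_pos hp, add_sub_add_right_eq_sub, add_sub_add_right_eq_sub]
      exact mul_le_mul_of_nonneg_left h hp.le
    · have h1 : HasDerivAt (fun t : ℝ => 2 * Real.pi - t) (-1) t := by
        simpa using (hasDerivAt_id t).const_sub (2 * Real.pi)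
      have h2 := ((hd (2 * Real.pi - t)).comp t h1).const_sub (2 * Real.pi * k)
      have e : Real.cos (2 * Real.pi * k - x (2 * Real.pi - t))
          = Real.cos (x (2 * Real.pi - t)) := by
        rw [mul_comm (2 * Real.pi) (k : ℝ), Real.cos_int_mul_two_pi_sub]
      refine h2.congr_deriv ?_
      simp only [e, Real.cos_two_pi_sub]
      ring
    · simp [hx0, hx2pi]
  have h := congrFun key Real.pi
  simp only [show 2 * Real.pi - Real.pi = Real.pi by ring] at h
  linarith
end

section
/- Let k be an integer. If x : ℝ → ℝ is differentiable, satisfies μ·x'(t) = cos(x(t)) + a + b·cos(t) for all t ∈ ℝ, x(0) = π, and x(2π) = π + 2πk, then x(π) = π + πk. (If the Poincaré map over the full period shifts the point π by 2πk, then the map over the half period shifts it by πk.) -/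
/-- If the Poincaré map of the Josephson equation over a full period shifts the
point `π` by `2πk`, then the map over the half period shifts it by `πk`. -/
theorem josephson_half_period_pi (μ a b : ℝ) (hμ : 0 < μ) (k : ℤ) (x : ℝ → ℝ)
    (hx : Differentiable ℝ x)
    (hode : ∀ t : ℝ, μ * deriv x t = Real.cos (x t) + a + b * Real.cos t)
    (hx0 : x 0 = Real.pi)
    (hx2pi : x (2 * Real.pi) = Real.pi + 2 * Real.pi * k) :
    x Real.pi = Real.pi + Real.pi * k := by
  have hd : ∀ t, HasDerivAt x (μ⁻¹ * (Real.cos (x t) + a + b * Real.cos t)) t := by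
    intro t
    have h := (hx t).hasDerivAt
    rwa [← hode t, inv_mul_cancel_left₀ hμ.ne']
  have hlip : ∀ t : ℝ, LipschitzOnWith (Real.toNNReal μ⁻¹)
      (fun y : ℝ => μ⁻¹ * (Real.cos y + a + b * Real.cos t)) Set.univ := by
    intro t
    rw [lipschitzOnWith_univ]
    apply lipschitzWith_of_nnnorm_deriv_le
    · fun_prop
    · intro y
      have h : HasDerivAt (fun y : ℝ => μ⁻¹ * (Real.cos y + a + b * Real.cos t))
          (μ⁻¹ * (-Real.sin y)) y :=
        (((Real.hasDerivAt_cos y).add_const a).add_const _).const_mul _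
      rw [h.deriv, ← NNReal.coe_le_coe, coe_nnnorm, Real.coe_toNNReal _ (by positivity),
        Real.norm_eq_abs, abs_mul, abs_neg, abs_of_pos (inv_pos.2 hμ)]
      exact mul_le_of_le_one_right (by positivity) (Real.abs_sin_le_one y)
  have hy : ∀ t, HasDerivAt (fun t => 2 * Real.pi + 2 * Real.pi * k - x (2 * Real.pi - t))
      (μ⁻¹ * (Real.cos (2 * Real.pi + 2 * Real.pi * k - x (2 * Real.pi - t)) + a
        + b * Real.cos t)) t := by
    intro t
    have h := ((hd (2 * Real.pi - t)).comp_const_sub (2 * Real.pi) t).const_sub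
      (2 * Real.pi + 2 * Real.pi * k)
    rw [neg_neg, Real.cos_two_pi_sub] at h
    have e : Real.cos (2 * Real.pi + 2 * Real.pi * k - x (2 * Real.pi - t))
        = Real.cos (x (2 * Real.pi - t)) := by
      rw [← Real.cos_int_mul_two_pi_sub _ (k + 1)]
      congr 1
      push_cast
      ring
    rw [e]
    exact h
  have key := ODE_solution_unique_univ (t₀ := 0) (s := fun _ => Set.univ) hlip
    (fun t => ⟨hd t, Set.mem_univ _⟩) (fun t => ⟨hy t, Set.mem_univ _⟩)
    (by simp only [sub_zero, hx0, hx2pi]; ring)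
  have h := congrFun key Real.pi
  simp only [show 2 * Real.pi - Real.pi = Real.pi by ring] at h
  linarith
end

section
/- Let I ⊆ ℝ be an interval, let c₀, c₁, c₂ : ℝ → ℝ be continuous, and let u₁, u₂, u₃, u₄ : I → ℝ be differentiable solutions of the Riccati equation uᵢ'(t) = c₀(t) + c₁(t)·uᵢ(t) + c₂(t)·uᵢ(t)² such that u₁(t), u₂(t), u₃(t), u₄(t) are pairwise distinct for every t ∈ I. Then the cross-ratio t ↦ ((u₁(t) − u₃(t))·(u₂(t) − u₄(t))) / ((u₁(t) − u₄(t))·(u₂(t) − u₃(t))) is constant on I. (The time-t flow maps of a Riccati equation are Möbius transformations.) -/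
/-- The cross-ratio of four pairwise distinct solutions of a Riccati equation
is constant in time (the flow maps of a Riccati equation are Möbius). -/
theorem riccati_cross_ratio_constant (I : Set ℝ) (hI : I.OrdConnected)
    (c₀ c₁ c₂ : ℝ → ℝ)
    (hc₀ : Continuous c₀) (hc₁ : Continuous c₁) (hc₂ : Continuous c₂)
    (u₁ u₂ u₃ u₄ : ℝ → ℝ)
    (h₁ : ∀ t ∈ I, HasDerivAt u₁ (c₀ t + c₁ t * u₁ t + c₂ t * u₁ t ^ 2) t)
    (h₂ : ∀ t ∈ I, HasDerivAt u₂ (c₀ t + c₁ t * u₂ t + c₂ t * u₂ t ^ 2) t)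
    (h₃ : ∀ t ∈ I, HasDerivAt u₃ (c₀ t + c₁ t * u₃ t + c₂ t * u₃ t ^ 2) t)
    (h₄ : ∀ t ∈ I, HasDerivAt u₄ (c₀ t + c₁ t * u₄ t + c₂ t * u₄ t ^ 2) t)
    (hdist : ∀ t ∈ I, u₁ t ≠ u₂ t ∧ u₁ t ≠ u₃ t ∧ u₁ t ≠ u₄ t ∧
      u₂ t ≠ u₃ t ∧ u₂ t ≠ u₄ t ∧ u₃ t ≠ u₄ t) :
    ∀ s ∈ I, ∀ t ∈ I,
      ((u₁ s - u₃ s) * (u₂ s - u₄ s)) / ((u₁ s - u₄ s) * (u₂ s - u₃ s)) =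
      ((u₁ t - u₃ t) * (u₂ t - u₄ t)) / ((u₁ t - u₄ t) * (u₂ t - u₃ t)) := by
  have key : ∀ t ∈ I, HasDerivAt (fun t => ((u₁ t - u₃ t) * (u₂ t - u₄ t)) /
      ((u₁ t - u₄ t) * (u₂ t - u₃ t))) 0 t := by
    intro t ht
    obtain ⟨-, -, h14, h23, -, -⟩ := hdist t ht
    have a14 := sub_ne_zero.mpr h14
    have a23 := sub_ne_zero.mpr h23
    have h := (((h₁ t ht).sub (h₃ t ht)).mul ((h₂ t ht).sub (h₄ t ht))).div
      (((h₁ t ht).sub (h₄ t ht)).mul ((h₂ t ht).sub (h₃ t ht))) (mul_ne_zero a14 a23)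
    refine h.congr_deriv ?_
    rw [div_eq_zero_iff]
    left
    simp only [Pi.sub_apply, Pi.mul_apply]
    ring
  intro s hs t ht
  have h := hI.convex.norm_image_sub_le_of_norm_hasDerivWithin_le (C := 0)
    (fun x hx => (key x hx).hasDerivWithinAt) (fun x _ => by simp) ht hs
  rw [zero_mul] at h
  exact sub_eq_zero.mp (norm_le_zero_iff.mp h)
end

section
/- Let A ∈ SL(2, ℝ) with |trace(A)| < 2 act on the real projective line by Möbius transformations. If there exist a point x in the real projective line and a positive integer q such that A^q fixes x, then A^q acts as the identity on the real projective line (i.e., A^q = ±Id). (An elliptic Möbius circle map with a periodic orbit is of finite order; this is the key step showing phase-lock cannot occur at non-integer rational rotation numbers.) -/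
theorem pow_lin_aux (M : Matrix (Fin 2) (Fin 2) ℝ) (n : ℕ) :
    ∃ s t : ℝ, M ^ n = s • M + t • (1 : Matrix (Fin 2) (Fin 2) ℝ) := by
  induction n with
  | zero => exact ⟨0, 1, by simp⟩
  | succ k ih =>
    obtain ⟨s, t, h⟩ := ih
    refine ⟨s * (M 0 0 + M 1 1) + t, - s * (M 0 0 * M 1 1 - M 0 1 * M 1 0), ?_⟩
    rw [pow_succ, h]
    ext i j
    fin_cases i <;> fin_cases j <;>
      simp [Matrix.mul_apply, Fin.sum_univ_two] <;> ring

/-- An elliptic element of `SL(2, ℝ)` whose `q`-th power fixes a point of the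
real projective line (i.e. has a real eigenvector) satisfies `A^q = ±Id`:
its `q`-th power acts as the identity on the projective line. -/
theorem elliptic_periodic_implies_finite_order
    (A : Matrix.SpecialLinearGroup (Fin 2) ℝ)
    (hA : |Matrix.trace (A : Matrix (Fin 2) (Fin 2) ℝ)| < 2)
    (q : ℕ) (hq : 0 < q)
    (hfix : ∃ v : Fin 2 → ℝ, v ≠ 0 ∧ ∃ c : ℝ,
      ((A ^ q : Matrix.SpecialLinearGroup (Fin 2) ℝ) :
        Matrix (Fin 2) (Fin 2) ℝ).mulVec v = c • v) :
    ((A ^ q : Matrix.SpecialLinearGroup (Fin 2) ℝ) :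
        Matrix (Fin 2) (Fin 2) ℝ) = 1 ∨
      ((A ^ q : Matrix.SpecialLinearGroup (Fin 2) ℝ) :
        Matrix (Fin 2) (Fin 2) ℝ) = -1 := by
  obtain ⟨v, hv, c, hc⟩ := hfix
  rw [Matrix.SpecialLinearGroup.coe_pow] at hc
  have hdq : ((A : Matrix (Fin 2) (Fin 2) ℝ) ^ q).det = 1 := by
    rw [Matrix.det_pow, A.det_coe, one_pow]
  have hd := A.det_coe
  rw [Matrix.SpecialLinearGroup.coe_pow]
  generalize (A : Matrix (Fin 2) (Fin 2) ℝ) = M at *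
  obtain ⟨s, t, h⟩ := pow_lin_aux M q
  rw [h] at hc hdq ⊢
  rw [Matrix.det_fin_two] at hd
  rw [Matrix.trace_fin_two, abs_lt] at hA
  have h0 := congrFun hc 0
  have h1 := congrFun hc 1
  simp [Matrix.mulVec, dotProduct, Fin.sum_univ_two] at h0 h1
  have hs : s = 0 := by
    by_contra hs
    have key : (s * M 0 0 + t - c) * (s * M 1 1 + t - c) - s * M 0 1 * (s * M 1 0) = 0 := by
      by_contra hk
      apply hv
      ext i
      fin_cases i
      · apply (mul_eq_zero.mp (_ : _ * v 0 = 0)).resolve_left hk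
        linear_combination (s * M 1 1 + t - c) * h0 - s * M 0 1 * h1
      · apply (mul_eq_zero.mp (_ : _ * v 1 = 0)).resolve_left hk
        linear_combination (s * M 0 0 + t - c) * h1 - s * M 1 0 * h0
    have hs2 : 0 < s ^ 2 := by positivity
    have e : (2 * (t - c) + s * (M 0 0 + M 1 1)) ^ 2
        + s ^ 2 * ((2 - (M 0 0 + M 1 1)) * (2 + (M 0 0 + M 1 1))) = 0 := by
      linear_combination 4 * key - 4 * s ^ 2 * hd
    have : 0 < s ^ 2 * ((2 - (M 0 0 + M 1 1)) * (2 + (M 0 0 + M 1 1))) :=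
      mul_pos hs2 (mul_pos (by linarith) (by linarith))
    nlinarith [sq_nonneg (2 * (t - c) + s * (M 0 0 + M 1 1))]
  subst hs
  have ht : t ^ 2 = 1 := by simpa using hdq
  rcases eq_or_eq_neg_of_sq_eq_sq t 1 (by rw [ht, one_pow]) with rfl | rfl
  · left; simp
  · right; simp
end

section
/- Let μ > 0, let l be a positive integer, and set a = √(1 + l²·μ²). If x : ℝ → ℝ is differentiable with μ·x'(t) = cos(x(t)) + a for all t ∈ ℝ and x(0) = 0, then x(π) = π·l and x(2π) = 2π·l. (At b = 0 the boundary of the l-th Arnold tongue passes through a = √(1 + l²μ²).) -/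
/-- Closed form of the phase `y - 2 arctan (sin y / (a + w + cos y))`. -/
theorem phase_hasDerivAt (a w : ℝ) (hw : 0 < w) (ha1 : 1 < a) (haw : a ^ 2 = 1 + w ^ 2) (y : ℝ) :
    HasDerivAt (fun y : ℝ => y - 2 * Real.arctan (Real.sin y / (a + w + Real.cos y)))
      (w / (a + Real.cos y)) y := by
  have hc := Real.neg_one_le_cos y
  have h1 : 0 < a + w + Real.cos y := by linarith
  have h2 : 0 < a + Real.cos y := by linarith
  have h3 := Real.sin_sq_add_cos_sq y
  have hq := (Real.hasDerivAt_sin y).div ((Real.hasDerivAt_cos y).const_add (a + w)) h1.ne'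
  have h := (hasDerivAt_id y).sub ((hq.arctan).const_mul 2)
  refine h.congr_deriv ?_
  simp only [Pi.div_apply]
  have h4 : (a + w + Real.cos y) ^ 2 + Real.sin y ^ 2 = 2 * (a + w) * (a + Real.cos y) := by
    linear_combination h3 - haw
  have h5 : 0 < a + w := by linarith
  have h6 : 1 + (Real.sin y / (a + w + Real.cos y)) ^ 2
      = 2 * (a + w) * (a + Real.cos y) / (a + w + Real.cos y) ^ 2 := by
    rw [← h4]; field_simp
  have h7 : Real.cos y * (a + w + Real.cos y) - Real.sin y * -Real.sin y
      = (a + w) * Real.cos y + 1 := by linear_combination h3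
  rw [h6, h7]
  field_simp
  linear_combination haw

/-- At `b = 0` the boundary of the `l`-th Arnold tongue of the Josephson
equation passes through `a = √(1 + l²μ²)`: the solution with `x(0) = 0`
satisfies `x(π) = πl` and `x(2π) = 2πl`. -/
theorem josephson_tongue_at_b_zero (μ : ℝ) (hμ : 0 < μ) (l : ℕ) (hl : 0 < l)
    (a : ℝ) (ha : a = Real.sqrt (1 + (l : ℝ) ^ 2 * μ ^ 2)) (x : ℝ → ℝ)
    (hx : Differentiable ℝ x)
    (hode : ∀ t : ℝ, μ * deriv x t = Real.cos (x t) + a)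
    (hx0 : x 0 = 0) :
    x Real.pi = Real.pi * l ∧ x (2 * Real.pi) = 2 * Real.pi * l := by
  have hl' : (0 : ℝ) < l := by exact_mod_cast hl
  have hw : 0 < (l : ℝ) * μ := by positivity
  have haw : a ^ 2 = 1 + ((l : ℝ) * μ) ^ 2 := by
    rw [ha, Real.sq_sqrt (by positivity)]; ring
  have ha0 : 0 ≤ a := ha ▸ Real.sqrt_nonneg _
  have ha1 : 1 < a := by nlinarith [sq_pos_of_pos hw]
  set G : ℝ → ℝ := fun y : ℝ =>
    y - 2 * Real.arctan (Real.sin y / (a + (l : ℝ) * μ + Real.cos y)) with hG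
  have hGd : ∀ y, HasDerivAt G ((l : ℝ) * μ / (a + Real.cos y)) y :=
    phase_hasDerivAt a _ hw ha1 haw
  have hpos : ∀ y, 0 < a + Real.cos y := fun y => by linarith [Real.neg_one_le_cos y]
  have hinj : Function.Injective G := by
    refine (strictMono_of_deriv_pos fun y => ?_).injective
    rw [(hGd y).deriv]
    exact div_pos hw (hpos y)
  have hphi : ∀ t, HasDerivAt (fun t => G (x t) - l * t) 0 t := by
    intro t
    have h := ((hGd (x t)).comp t (hx t).hasDerivAt).sub ((hasDerivAt_id t).const_mul (l : ℝ))
    refine h.congr_deriv ?_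
    have := hpos (x t)
    have h2 := hode t
    field_simp
    linear_combination (l : ℝ) * h2
  have hconst : ∀ t, G (x t) = l * t := by
    intro t
    have h := is_const_of_deriv_eq_zero (fun t => (hphi t).differentiableAt)
      (fun t => (hphi t).deriv) t 0
    have h0 : G 0 = 0 := by simp [hG]
    simp only [hx0, h0] at h
    linarith
  have hGn : ∀ n : ℕ, G (n * Real.pi) = n * Real.pi := by
    intro n
    simp [hG, Real.sin_nat_mul_pi]
  constructor
  · apply hinj
    rw [hconst, mul_comm Real.pi, hGn]
  · apply hinj
    have := hGn (2 * l)
    push_cast at this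
    rw [hconst, show 2 * Real.pi * (l : ℝ) = 2 * l * Real.pi by ring, this]
    ring
end
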